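/- Let m ∈ R^n with m̄ = 0 and Σ m_i² ≤ δ², and let X_1,…,X_n be i.i.d. from F_n, where {F_n} lies in a fixed Wasserstein-2 compact set Δ₀. Let X*_1,…,X*_n be i.i.d. from the empirical distribution F̂_n (conditionally on the sample). Then the Wasserstein-2 distance between the conditional law of Σ m_i X*_i given the sample and the law of Σ m_i X_i converges to 0 in probability. -/

import Mathlib

open MeasureTheory Filter

/-- A coupling of two measures on `ℝ`. -/
def IsCoupling (π : Measure (ℝ × ℝ)) (μ ν : Measure ℝ) : Prop :=
  π.map Prod.fst = μ ∧ π.map Prod.snd = ν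

/-- The 2-Wasserstein distance between measures on `ℝ`. -/
noncomputable def W2 (μ ν : Measure ℝ) : ℝ :=
  sInf ((fun π => (∫ p, (p.1 - p.2) ^ 2 ∂π) ^ ((1:ℝ)/2)) ''
    {π : Measure (ℝ × ℝ) | IsCoupling π μ ν})

/-- Membership in the Wasserstein-2 space over `ℝ`. -/
def MemW2Space (μ : Measure ℝ) : Prop :=
  IsProbabilityMeasure μ ∧ Integrable (fun x => x ^ 2) μ

/-- `Δ₀` is (sequentially) compact for the Wasserstein-2 metric. -/
def W2Compact (Δ₀ : Set (Measure ℝ)) : Prop :=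
  (∀ μ ∈ Δ₀, MemW2Space μ) ∧
  ∀ F : ℕ → Measure ℝ, (∀ n, F n ∈ Δ₀) →
    ∃ φ : ℕ → ℕ, StrictMono φ ∧ ∃ μ ∈ Δ₀, Tendsto (fun k => W2 (F (φ k)) μ) atTop (nhds 0)

/-- The empirical measure of the sample `ω : Fin n → ℝ`. -/
noncomputable def empiricalMeasure (n : ℕ) (ω : Fin n → ℝ) : Measure ℝ :=
  ((n : ENNReal)⁻¹) • ∑ i : Fin n, Measure.dirac (ω i)

lemma boot_split (p q : ENNReal) (hp : p ≠ ⊤) (hq : q ≠ ⊤) (κ : Measure ℝ) (hκ : κ Set.univ = p) :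
    (min p q / (p * q)) • q • κ + (1 - min p q / p) • κ = κ := by
  by_cases h0 : p = 0
  · have : κ = 0 := by rw [← Measure.measure_univ_eq_zero, hκ, h0]
    simp [this]
  rw [smul_smul, ← add_smul]
  have h1 : min p q / (p * q) * q = min p q / p := by
    by_cases hq0 : q = 0
    · simp [hq0]
    rw [div_eq_mul_inv, div_eq_mul_inv, ENNReal.mul_inv (Or.inl h0) (Or.inl hp), mul_assoc, mul_assoc,
      ENNReal.inv_mul_cancel hq0 hq, mul_one]
  rw [h1, add_tsub_cancel_of_le, one_smul]
  exact ENNReal.div_le_of_le_mul (by simp)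

lemma boot_mass (p q : ENNReal) (hp : p ≠ ⊤) : (1 - min p q / p) * p = p - q := by
  by_cases h0 : p = 0
  · simp [h0]
  rw [ENNReal.sub_mul (fun _ _ => hp), one_mul, ENNReal.div_mul_cancel h0 hp]
  rcases le_total p q with h | h
  · simp [h, tsub_eq_zero_of_le h]
  · simp [h]

lemma boot_coupling {ι : Type*} [Fintype ι] [MeasurableSpace ι] [MeasurableSingletonClass ι]
    (μ ν : Measure ℝ) [IsProbabilityMeasure μ] [IsProbabilityMeasure ν] (f : ℝ → ι)
    (hf : Measurable f) :
    ∃ π : Measure (ℝ × ℝ), IsCoupling π μ ν ∧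
      π {p | f p.1 ≠ f p.2} ≤ ∑ j, (μ (f ⁻¹' {j}) - ν (f ⁻¹' {j})) := by
  classical
  have hA : ∀ j, MeasurableSet (f ⁻¹' {j}) := fun j => hf (measurableSet_singleton j)
  have hsum : ∀ (κ : Measure ℝ), ∑ j, κ.restrict (f ⁻¹' {j}) = κ := by
    intro κ
    rw [← Measure.sum_fintype, ← Measure.restrict_iUnion _ hA]
    · have : (⋃ j, f ⁻¹' {j}) = Set.univ := by ext; simp
      rw [this, Measure.restrict_univ]
    · intro i j hij
      rw [Function.onFun, Set.disjoint_left]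
      intro x hx hy
      simp at hx hy
      exact hij (hx.symm.trans hy)
  have hone : ∀ (κ : Measure ℝ) [IsProbabilityMeasure κ], ∑ j, κ (f ⁻¹' {j}) = 1 := by
    intro κ _
    have := congrArg (fun m : Measure ℝ => m Set.univ) (hsum κ)
    simpa using this
  set r := ∑ j, (μ (f ⁻¹' {j}) - ν (f ⁻¹' {j})) with hr
  have hr' : ∑ j, (ν (f ⁻¹' {j}) - μ (f ⁻¹' {j})) = r := by
    have : ∑ j, (μ (f ⁻¹' {j}) + (ν (f ⁻¹' {j}) - μ (f ⁻¹' {j})))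
        = ∑ j, (ν (f ⁻¹' {j}) + (μ (f ⁻¹' {j}) - ν (f ⁻¹' {j}))) := by
      refine Finset.sum_congr rfl fun j _ => ?_
      rw [add_tsub_eq_max, add_tsub_eq_max, max_comm]
    rw [Finset.sum_add_distrib, Finset.sum_add_distrib, hone, hone] at this
    exact (ENNReal.add_right_inj ENNReal.one_ne_top).1 this
  have hrtop : r ≠ ⊤ := by
    refine ne_of_lt (lt_of_le_of_lt (b := (1 : ENNReal)) ?_ ENNReal.one_lt_top)
    rw [← hone μ]
    exact Finset.sum_le_sum fun j _ => tsub_le_self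
  let p := fun j => μ (f ⁻¹' {j})
  let q := fun j => ν (f ⁻¹' {j})
  let ρ₁ : Measure ℝ := ∑ j, (1 - min (p j) (q j) / p j) • μ.restrict (f ⁻¹' {j})
  let ρ₂ : Measure ℝ := ∑ j, (1 - min (q j) (p j) / q j) • ν.restrict (f ⁻¹' {j})
  have hρ₁ : ρ₁ Set.univ = r := by
    simp only [ρ₁, Measure.coe_finsetSum, Finset.sum_apply, Measure.smul_apply, smul_eq_mul,
      Measure.restrict_apply_univ]
    exact Finset.sum_congr rfl fun j _ => boot_mass _ _ (measure_ne_top _ _)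
  have hρ₂ : ρ₂ Set.univ = r := by
    rw [← hr']
    simp only [ρ₂, Measure.coe_finsetSum, Finset.sum_apply, Measure.smul_apply, smul_eq_mul,
      Measure.restrict_apply_univ]
    exact Finset.sum_congr rfl fun j _ => boot_mass _ _ (measure_ne_top _ _)
  have : IsFiniteMeasure ρ₁ := ⟨by rw [hρ₁]; exact hrtop.lt_top⟩
  have : IsFiniteMeasure ρ₂ := ⟨by rw [hρ₂]; exact hrtop.lt_top⟩
  have hres : ∀ κ : Measure ℝ, κ Set.univ = r → r⁻¹ • r • κ = κ := by
    intro κ hκ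
    by_cases h0 : r = 0
    · have : κ = 0 := by rw [← Measure.measure_univ_eq_zero, hκ, h0]
      simp [this]
    · rw [smul_smul, ENNReal.inv_mul_cancel h0 hrtop, one_smul]
  refine ⟨∑ j, (min (p j) (q j) / (p j * q j)) •
      (μ.restrict (f ⁻¹' {j})).prod (ν.restrict (f ⁻¹' {j})) + r⁻¹ • ρ₁.prod ρ₂, ⟨?_, ?_⟩, ?_⟩
  · rw [Measure.map_add _ _ measurable_fst, Measure.map_smul, Measure.map_fst_prod, hρ₂, hres _ hρ₁,
      ← Measure.mapₗ_apply_of_measurable measurable_fst, map_sum]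
    simp only [Measure.mapₗ_apply_of_measurable measurable_fst, Measure.map_smul,
      Measure.map_fst_prod, Measure.restrict_apply_univ, ρ₁]
    rw [← Finset.sum_add_distrib, ← hsum μ]
    refine Finset.sum_congr rfl fun j _ => ?_
    rw [hsum μ]
    exact boot_split _ _ (measure_ne_top _ _) (measure_ne_top _ _) _ (by simp)
  · rw [Measure.map_add _ _ measurable_snd, Measure.map_smul, Measure.map_snd_prod, hρ₁, hres _ hρ₂,
      ← Measure.mapₗ_apply_of_measurable measurable_snd, map_sum]
    simp only [Measure.mapₗ_apply_of_measurable measurable_snd, Measure.map_smul,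
      Measure.map_snd_prod, Measure.restrict_apply_univ, ρ₂]
    rw [← Finset.sum_add_distrib, ← hsum ν]
    refine Finset.sum_congr rfl fun j _ => ?_
    rw [hsum ν, min_comm, mul_comm]
    exact boot_split _ _ (measure_ne_top _ _) (measure_ne_top _ _) _ (by simp)
  · have hm : MeasurableSet {p : ℝ × ℝ | f p.1 ≠ f p.2} := by
      have : {p : ℝ × ℝ | f p.1 ≠ f p.2} = (⋃ j, (f ⁻¹' {j}) ×ˢ (f ⁻¹' {j}))ᶜ := by
        ext ⟨x, y⟩
        simp [eq_comm]
      rw [this]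
      exact (MeasurableSet.iUnion fun j => (hA j).prod (hA j)).compl
    rw [Measure.add_apply, Measure.coe_finsetSum, Finset.sum_apply, Finset.sum_eq_zero, zero_add,
      Measure.smul_apply, smul_eq_mul]
    · calc r⁻¹ * (ρ₁.prod ρ₂) {p | f p.1 ≠ f p.2} ≤ r⁻¹ * (ρ₁.prod ρ₂) (Set.univ ×ˢ Set.univ) := by
            gcongr; simp
        _ = r⁻¹ * r * r := by rw [Measure.prod_prod, hρ₁, hρ₂, mul_assoc]
        _ ≤ 1 * r := by gcongr; exact ENNReal.inv_mul_le_one r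
        _ = r := one_mul r
    · intro j _
      rw [Measure.smul_apply, Measure.prod_restrict, Measure.restrict_apply hm]
      have : {p : ℝ × ℝ | f p.1 ≠ f p.2} ∩ (f ⁻¹' {j}) ×ˢ (f ⁻¹' {j}) = ∅ := by
        ext ⟨x, y⟩
        simp
        intro h h1 h2
        exact h (h1.trans h2.symm)
      rw [this]; simp

lemma W2_le {μ ν : Measure ℝ} {π : Measure (ℝ × ℝ)} (h : IsCoupling π μ ν) :
    W2 μ ν ≤ (∫ p, (p.1 - p.2) ^ 2 ∂π) ^ ((1:ℝ)/2) := by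
  refine csInf_le ⟨0, ?_⟩ ⟨π, h, rfl⟩
  rintro _ ⟨π, -, rfl⟩
  exact Real.rpow_nonneg (integral_nonneg fun _ => sq_nonneg _) _

lemma coupling_prob {μ ν : Measure ℝ} [IsProbabilityMeasure μ] {π : Measure (ℝ × ℝ)}
    (h : IsCoupling π μ ν) : IsProbabilityMeasure π := by
  have : IsProbabilityMeasure (π.map Prod.fst) := by rw [h.1]; infer_instance
  exact (Measure.isProbabilityMeasure_map_iff measurable_fst.aemeasurable).1 this

lemma coupling_int {μ ν : Measure ℝ} {π : Measure (ℝ × ℝ)}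
    (h : IsCoupling π μ ν) {g : ℝ → ℝ} (hg : Measurable g) :
    (Integrable g μ → Integrable (fun p => g p.1) π) ∧
    (Integrable g ν → Integrable (fun p => g p.2) π) ∧
    ∫ p, g p.1 ∂π = ∫ x, g x ∂μ ∧ ∫ p, g p.2 ∂π = ∫ x, g x ∂ν := by
  refine ⟨fun hi => ?_, fun hi => ?_, ?_, ?_⟩
  · rw [← h.1] at hi
    exact hi.comp_measurable measurable_fst
  · rw [← h.2] at hi
    exact hi.comp_measurable measurable_snd
  · rw [← h.1, integral_map measurable_fst.aemeasurable hg.aestronglyMeasurable]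
  · rw [← h.2, integral_map measurable_snd.aemeasurable hg.aestronglyMeasurable]

lemma coupling_sq_int {μ ν : Measure ℝ} {π : Measure (ℝ × ℝ)} (h : IsCoupling π μ ν)
    (hμ : Integrable (fun x => x ^ 2) μ) (hν : Integrable (fun x => x ^ 2) ν) :
    Integrable (fun p : ℝ × ℝ => (p.1 - p.2) ^ 2) π := by
  have h1 := (coupling_int h (g := fun x => x ^ 2) (by fun_prop)).1 hμ
  have h2 := (coupling_int h (g := fun x => x ^ 2) (by fun_prop)).2.1 hν
  refine ((h1.const_mul 2).add (h2.const_mul 2)).mono' (by fun_prop) (ae_of_all _ fun p => ?_)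
  rw [Real.norm_of_nonneg (sq_nonneg _)]
  simp only [Pi.add_apply]
  nlinarith [sq_nonneg (p.1 + p.2)]

lemma W2_lt_exists {μ ν : Measure ℝ} [IsProbabilityMeasure μ] [IsProbabilityMeasure ν] {a : ℝ}
    (h : W2 μ ν < a) : ∃ π, IsCoupling π μ ν ∧ ∫ p, (p.1 - p.2) ^ 2 ∂π < a ^ 2 := by
  obtain ⟨_, ⟨π, hπ, rfl⟩, hlt⟩ := exists_lt_of_csInf_lt
    (Set.Nonempty.image _ ⟨μ.prod ν, by simp [IsCoupling, Measure.map_fst_prod, Measure.map_snd_prod]⟩) h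
  refine ⟨π, hπ, ?_⟩
  have h0 : 0 ≤ ∫ p, (p.1 - p.2) ^ 2 ∂π := integral_nonneg fun _ => sq_nonneg _
  simp only [← Real.sqrt_eq_rpow] at hlt
  exact (Real.sqrt_lt' (lt_of_le_of_lt (Real.sqrt_nonneg _) hlt)).1 hlt

/-- truncated square -/
noncomputable def tsq (R x : ℝ) : ℝ := if R < |x| then x ^ 2 else 0

lemma tsq_meas (R : ℝ) : Measurable (tsq R) := by
  unfold tsq
  exact Measurable.ite (measurableSet_lt measurable_const (by fun_prop)) (by fun_prop) (by fun_prop)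

lemma tsq_nonneg (R x : ℝ) : 0 ≤ tsq R x := by
  unfold tsq; split_ifs <;> positivity

lemma tsq_le (R x : ℝ) : tsq R x ≤ x ^ 2 := by
  unfold tsq; split_ifs <;> first | rfl | positivity

lemma tsq_int (R : ℝ) {μ : Measure ℝ} (hμ : Integrable (fun x => x ^ 2) μ) :
    Integrable (tsq R) μ := by
  refine hμ.mono' (tsq_meas R).aestronglyMeasurable (ae_of_all _ fun x => ?_)
  rw [Real.norm_of_nonneg (tsq_nonneg _ _)]
  exact tsq_le _ _

lemma tsq_bound {R R' : ℝ} (hR : 0 ≤ R) (h : 2 * R ≤ R') (x y : ℝ) :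
    tsq R' x ≤ 4 * (x - y) ^ 2 + 4 * tsq R y := by
  unfold tsq
  split_ifs with h1 h2 h2
  · nlinarith [sq_nonneg (x - 2 * y)]
  · have : |x| ≤ 2 * |x - y| := by
      have := abs_sub_abs_le_abs_sub x y
      linarith
    have h3 := pow_le_pow_left₀ (abs_nonneg x) this 2
    rw [mul_pow, sq_abs, sq_abs] at h3
    linarith
  · positivity
  · positivity

lemma tsq_tendsto {μ : Measure ℝ} (hμ : Integrable (fun x => x ^ 2) μ) :
    Tendsto (fun k : ℕ => ∫ x, tsq k x ∂μ) atTop (nhds 0) := by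
  have : Tendsto (fun k : ℕ => ∫ x, tsq k x ∂μ) atTop (nhds (∫ x, (0:ℝ) ∂μ)) := by
    refine tendsto_integral_of_dominated_convergence (fun x => x ^ 2)
      (fun k => (tsq_meas k).aestronglyMeasurable) hμ (fun k => ae_of_all _ fun x => ?_)
      (ae_of_all _ fun x => ?_)
    · rw [Real.norm_of_nonneg (tsq_nonneg _ _)]
      exact tsq_le _ _
    · refine tendsto_const_nhds.congr' ?_
      filter_upwards [eventually_ge_atTop ⌈|x|⌉₊] with k hk
      have : |x| ≤ k := Nat.ceil_le.1 hk
      simp [tsq, this]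
  simpa using this

lemma unif_int {Δ₀ : Set (Measure ℝ)} (hΔ₀ : W2Compact Δ₀) {c : ℝ} (hc : 0 < c) :
    ∃ R : ℕ, ∀ μ ∈ Δ₀, ∫ x, tsq R x ∂μ ≤ c := by
  by_contra! H
  choose G hG hGc using H
  obtain ⟨φ, hφ, μ, hμ, hlim⟩ := hΔ₀.2 G hG
  have hμ2 := hΔ₀.1 μ hμ
  have := hμ2.1
  obtain ⟨R, hR⟩ := ((tsq_tendsto hμ2.2).eventually_lt_const (show (0:ℝ) < c / 8 by positivity)).exists
  obtain ⟨k, hk1, hk2⟩ := ((hlim.eventually_lt_const (show (0:ℝ) < Real.sqrt (c / 8) by positivity)).and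
    (eventually_ge_atTop (2 * R))).exists
  have hG2 := hΔ₀.1 _ (hG (φ k))
  have := hG2.1
  obtain ⟨π, hπ, hlt⟩ := W2_lt_exists hk1
  rw [Real.sq_sqrt (by positivity)] at hlt
  have hge : 2 * R ≤ φ k := hk2.trans (hφ.id_le k)
  have hge' : (2 : ℝ) * R ≤ φ k := by exact_mod_cast hge
  have h1 := coupling_int hπ (tsq_meas (φ k))
  have h2 := coupling_int hπ (tsq_meas R)
  have h3 : ∫ p, tsq (φ k) p.1 ∂π ≤ ∫ p, (4 * (p.1 - p.2) ^ 2 + 4 * tsq R p.2) ∂π :=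
    integral_mono (h1.1 (tsq_int _ hG2.2))
      (((coupling_sq_int hπ hG2.2 hμ2.2).const_mul 4).add ((h2.2.1 (tsq_int _ hμ2.2)).const_mul 4))
      fun p => tsq_bound (by positivity) hge' _ _
  rw [integral_add ((coupling_sq_int hπ hG2.2 hμ2.2).const_mul 4)
    ((h2.2.1 (tsq_int _ hμ2.2)).const_mul 4), integral_const_mul, integral_const_mul, h1.2.2.1,
    h2.2.2.2] at h3
  have := hGc (φ k)
  linarith

lemma pi_sq {Ω : Type*} [MeasurableSpace Ω] (π : Measure Ω) [IsProbabilityMeasure π] {n : ℕ}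
    (a : Fin n → ℝ) (g : Ω → ℝ) (hg : MemLp g 2 π) (h0 : (∑ i, a i = 0) ∨ ∫ x, g x ∂π = 0) :
    MemLp (fun y : Fin n → Ω => ∑ i, a i * g (y i)) 2 (Measure.pi fun _ => π) ∧
    ∫ y : Fin n → Ω, (∑ i, a i * g (y i)) ^ 2 ∂(Measure.pi fun _ => π)
      ≤ (∑ i, a i ^ 2) * ∫ x, g x ^ 2 ∂π := by
  have hmi : ∀ i, MemLp (fun y : Fin n → Ω => a i * g (y i)) 2 (Measure.pi fun _ => π) := fun i =>
    (hg.comp_measurePreserving (measurePreserving_eval (fun _ : Fin n => π) i)).const_mul (a i)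
  have hm : MemLp (fun y : Fin n → Ω => ∑ i, a i * g (y i)) 2 (Measure.pi fun _ => π) :=
    memLp_finsetSum _ fun i _ => hmi i
  refine ⟨hm, ?_⟩
  have hE : ∫ y : Fin n → Ω, (∑ i, a i * g (y i)) ∂(Measure.pi fun _ => π) = 0 := by
    rw [integral_finsetSum _ fun i _ => (hmi i).integrable (by norm_num)]
    have : ∀ i : Fin n, ∫ y : Fin n → Ω, a i * g (y i) ∂(Measure.pi fun _ => π) = a i * ∫ x, g x ∂π := by
      intro i
      rw [integral_const_mul]
      congr 1
      exact integral_comp_eval (μ := fun _ : Fin n => π) (i := i) hg.1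
    simp only [this, ← Finset.sum_mul]
    rcases h0 with h | h <;> simp [h]
  have hV := ProbabilityTheory.variance_sum_pi (μ := fun _ : Fin n => π) (X := fun i x => a i * g x)
    (fun i => hg.const_mul (a i))
  have hfun : (∑ i, fun ω : Fin n → Ω => a i * g (ω i)) = fun y : Fin n → Ω => ∑ i, a i * g (y i) := by
    ext; simp
  rw [hfun, ProbabilityTheory.variance_eq_sub hm, hE] at hV
  simp only [Pi.pow_apply] at hV
  rw [zero_pow two_ne_zero, sub_zero] at hV
  rw [hV, Finset.sum_mul]
  refine Finset.sum_le_sum fun i _ => ?_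
  refine (ProbabilityTheory.variance_le_expectation_sq (hg.const_mul (a i)).1).trans ?_
  simp only [Pi.pow_apply, mul_pow]
  rw [integral_const_mul]

lemma W2_linear {μ ν : Measure ℝ} [IsProbabilityMeasure μ] [IsProbabilityMeasure ν]
    {π : Measure (ℝ × ℝ)} (h : IsCoupling π μ ν)
    (hμ : Integrable (fun x => x ^ 2) μ) (hν : Integrable (fun x => x ^ 2) ν) {n : ℕ}
    (a : Fin n → ℝ) (ha : ∑ i, a i = 0) {δ : ℝ} (hδ : ∑ i, a i ^ 2 ≤ δ ^ 2) :
    W2 ((Measure.pi fun _ : Fin n => μ).map (fun y => ∑ i, a i * y i))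
      ((Measure.pi fun _ : Fin n => ν).map (fun y => ∑ i, a i * y i))
      ≤ Real.sqrt (δ ^ 2 * ∫ p, (p.1 - p.2) ^ 2 ∂π) := by
  have hπ := coupling_prob h
  have hT : Measurable (fun y : Fin n → ℝ × ℝ => (∑ i, a i * (y i).1, ∑ i, a i * (y i).2)) := by
    fun_prop
  have hc : IsCoupling ((Measure.pi fun _ : Fin n => π).map
      (fun y : Fin n → ℝ × ℝ => (∑ i, a i * (y i).1, ∑ i, a i * (y i).2)))
      ((Measure.pi fun _ : Fin n => μ).map (fun y => ∑ i, a i * y i))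
      ((Measure.pi fun _ : Fin n => ν).map (fun y => ∑ i, a i * y i)) := by
    have h1 := Measure.pi_map_pi (μ := fun _ : Fin n => π) (f := fun _ => Prod.fst)
      (fun _ => measurable_fst.aemeasurable)
      (hμ := fun _ => by rw [h.1]; infer_instance)
    have h2 := Measure.pi_map_pi (μ := fun _ : Fin n => π) (f := fun _ => Prod.snd)
      (fun _ => measurable_snd.aemeasurable)
      (hμ := fun _ => by rw [h.2]; infer_instance)
    simp only [h.1] at h1
    simp only [h.2] at h2
    constructor
    · rw [← h1, Measure.map_map measurable_fst hT, Measure.map_map (by fun_prop) (by fun_prop)]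
      rfl
    · rw [← h2, Measure.map_map measurable_snd hT, Measure.map_map (by fun_prop) (by fun_prop)]
      rfl
  refine (W2_le hc).trans ?_
  rw [← Real.sqrt_eq_rpow]
  apply Real.sqrt_le_sqrt
  rw [integral_map hT.aemeasurable (by fun_prop)]
  have hm : MemLp (fun p : ℝ × ℝ => p.1 - p.2) 2 π :=
    (memLp_two_iff_integrable_sq (by fun_prop)).2 (coupling_sq_int h hμ hν)
  have := (pi_sq π a (fun p : ℝ × ℝ => p.1 - p.2) hm (Or.inl ha)).2
  have hI : 0 ≤ ∫ p, (p.1 - p.2) ^ 2 ∂π := integral_nonneg fun _ => sq_nonneg _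
  refine le_trans (le_of_eq ?_) (this.trans (mul_le_mul_of_nonneg_right hδ hI))
  congr 1
  ext y
  simp only [mul_sub, Finset.sum_sub_distrib]

lemma emp_prob {n : ℕ} (hn : n ≠ 0) (ω : Fin n → ℝ) :
    IsProbabilityMeasure (empiricalMeasure n ω) := by
  constructor
  simp [empiricalMeasure]
  exact ENNReal.inv_mul_cancel (by simpa using hn) (by simp)

lemma emp_int {n : ℕ} (hn : n ≠ 0) (ω : Fin n → ℝ) {g : ℝ → ℝ} :
    Integrable g (empiricalMeasure n ω) ∧
    ∫ x, g x ∂(empiricalMeasure n ω) = ∑ i, (n : ℝ)⁻¹ * g (ω i) := by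
  have hi : ∀ i ∈ Finset.univ, Integrable g (Measure.dirac (ω i)) := fun i _ =>
    integrable_dirac (by simp)
  unfold empiricalMeasure
  constructor
  · exact (integrable_finsetSum_measure.2 hi).smul_measure (by simpa using hn)
  · rw [integral_smul_measure, integral_finsetSum_measure hi, ← Finset.mul_sum]
    simp

lemma quant (R : ℕ) {η : ℝ} (hη : 0 < η) :
    ∃ N : ℕ, ∃ f : ℝ → Fin N, Measurable f ∧ ∀ x y, (x - y) ^ 2 ≤
      η ^ 2 + 4 * R ^ 2 * (Set.indicator {p : ℝ × ℝ | f p.1 ≠ f p.2} 1 (x, y))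
        + 4 * tsq R x + 4 * tsq R y := by
  obtain ⟨N, hN⟩ := exists_nat_gt ((R + R) / η)
  refine ⟨N + 1, fun x => ⟨min ⌊(x + R) / η⌋₊ N, by omega⟩, ?_, fun x y => ?_⟩
  · have h1 : Measurable (fun x : ℝ => min ⌊(x + R) / η⌋₊ N) :=
      (Nat.measurable_floor.comp (by fun_prop)).min measurable_const
    have h2 : Measurable (fun k : ℕ => (⟨min k N, by omega⟩ : Fin (N + 1))) :=
      measurable_from_top
    convert h2.comp h1 using 2 with x
    simp
  have hind : 0 ≤ 4 * (R : ℝ) ^ 2 * (Set.indicator {p : ℝ × ℝ |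
      (⟨min ⌊(p.1 + R) / η⌋₊ N, by omega⟩ : Fin (N + 1)) ≠ ⟨min ⌊(p.2 + R) / η⌋₊ N, by omega⟩}
        1 (x, y)) := by
    refine mul_nonneg (by positivity) (Set.indicator_nonneg (fun _ _ => by simp) _)
  have ht1 := tsq_nonneg R x
  have ht2 := tsq_nonneg R y
  have hη2 := sq_nonneg η
  by_cases hx : (R : ℝ) < |x|
  · have hxx : tsq R x = x ^ 2 := if_pos hx
    by_cases hy : (R : ℝ) < |y|
    · have hyy : tsq R y = y ^ 2 := if_pos hy
      nlinarith [sq_nonneg (x + y)]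
    · have : y ^ 2 ≤ x ^ 2 := sq_le_sq.2 (by linarith)
      nlinarith [sq_nonneg (x + y)]
  · by_cases hy : (R : ℝ) < |y|
    · have hyy : tsq R y = y ^ 2 := if_pos hy
      have : x ^ 2 ≤ y ^ 2 := sq_le_sq.2 (by linarith)
      nlinarith [sq_nonneg (x + y)]
    · push Not at hx hy
      obtain ⟨hx1, hx2⟩ := abs_le.1 hx
      obtain ⟨hy1, hy2⟩ := abs_le.1 hy
      by_cases hf : min ⌊(x + R) / η⌋₊ N = min ⌊(y + R) / η⌋₊ N
      · have hb : ∀ z : ℝ, -R ≤ z → z ≤ R → ⌊(z + R) / η⌋₊ < N ∧ 0 ≤ (z + R) / η := by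
          intro z hz1 hz2
          have h0 : 0 ≤ (z + R) / η := div_nonneg (by linarith) hη.le
          refine ⟨(Nat.floor_lt h0).2 (lt_of_le_of_lt ?_ hN), h0⟩
          gcongr
        obtain ⟨a1, a2⟩ := hb x hx1 hx2
        obtain ⟨b1, b2⟩ := hb y hy1 hy2
        rw [min_eq_left a1.le, min_eq_left b1.le] at hf
        have c1 := Nat.floor_le a2
        have c2 := Nat.lt_floor_add_one ((x + R) / η)
        have c3 := Nat.floor_le b2
        have c4 := Nat.lt_floor_add_one ((y + R) / η)
        rw [hf] at c1 c2
        rw [le_div_iff₀ hη] at c1 c3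
        rw [div_lt_iff₀ hη] at c2 c4
        have : (x - y) ^ 2 ≤ η ^ 2 := sq_le_sq.2 (by
          rw [abs_of_pos hη, abs_le]; constructor <;> nlinarith)
        linarith
      · rw [Set.indicator_of_mem (by simpa using hf)]
        have : (x - y) ^ 2 ≤ (2 * R) ^ 2 := sq_le_sq.2 (by
          rw [abs_of_nonneg (by positivity : (0:ℝ) ≤ 2 * R), abs_le]; constructor <;> linarith)
        simp only [Pi.one_apply]
        linarith

lemma W2_point {ν : Measure ℝ} (hν : MemW2Space ν) {n : ℕ} (hn : n ≠ 0) (ω : Fin n → ℝ)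
    (a : Fin n → ℝ) (ha : ∑ i, a i = 0) {δ : ℝ} (hδ : ∑ i, a i ^ 2 ≤ δ ^ 2)
    {R N : ℕ} {η : ℝ} {f : ℝ → Fin N} (hf : Measurable f)
    (H : ∀ x y, (x - y) ^ 2 ≤
      η ^ 2 + 4 * R ^ 2 * (Set.indicator {p : ℝ × ℝ | f p.1 ≠ f p.2} 1 (x, y))
        + 4 * tsq R x + 4 * tsq R y) :
    W2 ((Measure.pi fun _ : Fin n => empiricalMeasure n ω).map (fun y => ∑ i, a i * y i))
      ((Measure.pi fun _ : Fin n => ν).map (fun y => ∑ i, a i * y i))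
      ≤ Real.sqrt (δ ^ 2 * (η ^ 2 +
        4 * R ^ 2 * (∑ j, |∑ i, (n : ℝ)⁻¹ * ((f ⁻¹' {j}).indicator 1 (ω i) - ν.real (f ⁻¹' {j}))|)
        + 4 * (∑ i, (n : ℝ)⁻¹ * tsq R (ω i)) + 4 * ∫ x, tsq R x ∂ν)) := by
  have := hν.1
  have := emp_prob hn ω
  obtain ⟨π, hπ, hle⟩ := boot_coupling (empiricalMeasure n ω) ν f hf
  have hsq : Integrable (fun x : ℝ => x ^ 2) (empiricalMeasure n ω) := (emp_int hn ω).1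
  have hπp := coupling_prob hπ
  refine (W2_linear hπ hsq hν.2 a ha hδ).trans ?_
  apply Real.sqrt_le_sqrt
  apply mul_le_mul_of_nonneg_left _ (sq_nonneg δ)
  have hm : MeasurableSet {p : ℝ × ℝ | f p.1 ≠ f p.2} :=
    (measurableSet_eq_fun (hf.comp measurable_fst) (hf.comp measurable_snd)).compl
  have hc := coupling_int hπ (tsq_meas R)
  have i1 : Integrable (fun p : ℝ × ℝ => 4 * tsq R p.1) π := (hc.1 (tsq_int R hsq)).const_mul 4
  have i2 : Integrable (fun p : ℝ × ℝ => 4 * tsq R p.2) π := (hc.2.1 (tsq_int R hν.2)).const_mul 4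
  have i3 : Integrable (fun p : ℝ × ℝ => 4 * (R:ℝ) ^ 2 *
      (Set.indicator {p : ℝ × ℝ | f p.1 ≠ f p.2} (1 : ℝ × ℝ → ℝ) p)) π :=
    ((integrable_const (1:ℝ)).indicator hm).const_mul _
  have i4 : Integrable (fun p : ℝ × ℝ => η ^ 2) π := integrable_const _
  have key : ∫ p, (p.1 - p.2) ^ 2 ∂π ≤ ∫ p, (η ^ 2 + 4 * R ^ 2 *
      (Set.indicator {p : ℝ × ℝ | f p.1 ≠ f p.2} (1 : ℝ × ℝ → ℝ) p)
        + 4 * tsq R p.1 + 4 * tsq R p.2) ∂π :=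
    integral_mono (coupling_sq_int hπ hsq hν.2) (((i4.add i3).add i1).add i2) fun p => H p.1 p.2
  have i5 : Integrable (fun p : ℝ × ℝ => η ^ 2 + 4 * (R:ℝ) ^ 2 *
      (Set.indicator {p : ℝ × ℝ | f p.1 ≠ f p.2} (1 : ℝ × ℝ → ℝ) p)) π := i4.add i3
  have i6 : Integrable (fun p : ℝ × ℝ => η ^ 2 + 4 * (R:ℝ) ^ 2 *
      (Set.indicator {p : ℝ × ℝ | f p.1 ≠ f p.2} (1 : ℝ × ℝ → ℝ) p) + 4 * tsq R p.1) π := i5.add i1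
  rw [integral_add i6 i2, integral_add i5 i1, integral_add i4 i3,
    integral_const_mul, integral_const_mul, integral_const_mul, hc.2.2.1, hc.2.2.2,
    (emp_int hn ω).2, integral_indicator_one hm] at key
  simp only [integral_const, probReal_univ, one_smul] at key
  refine key.trans ?_
  have hreal : ∀ j, (empiricalMeasure n ω).real (f ⁻¹' {j}) - ν.real (f ⁻¹' {j}) =
      ∑ i, (n : ℝ)⁻¹ * ((f ⁻¹' {j}).indicator 1 (ω i) - ν.real (f ⁻¹' {j})) := by
    intro j
    rw [← integral_indicator_one (μ := empiricalMeasure n ω) (hf (measurableSet_singleton j)),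
      (emp_int hn ω).2]
    simp only [mul_sub, Finset.sum_sub_distrib]
    have : (n : ℝ) ≠ 0 := by exact_mod_cast hn
    simp [this]
  have h5 : π.real {p : ℝ × ℝ | f p.1 ≠ f p.2} ≤
      ∑ j, |∑ i, (n : ℝ)⁻¹ * ((f ⁻¹' {j}).indicator 1 (ω i) - ν.real (f ⁻¹' {j}))| := by
    simp only [← hreal]
    have hfin : ∀ j ∈ Finset.univ, empiricalMeasure n ω (f ⁻¹' {j}) - ν (f ⁻¹' {j}) ≠ ⊤ := fun j _ =>
      ne_top_of_le_ne_top (measure_ne_top (empiricalMeasure n ω) _) tsub_le_self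
    refine (ENNReal.toReal_mono (ENNReal.sum_ne_top.2 hfin) hle).trans ?_
    rw [ENNReal.toReal_sum hfin]
    refine Finset.sum_le_sum fun j _ => ?_
    rcases le_total (ν (f ⁻¹' {j})) (empiricalMeasure n ω (f ⁻¹' {j})) with h | h
    · rw [ENNReal.toReal_sub_of_le h (measure_ne_top _ _)]
      exact le_abs_self _
    · rw [tsub_eq_zero_of_le h]
      simp
  gcongr

lemma E_tsq {ν : Measure ℝ} (hν : MemW2Space ν) {n : ℕ} (hn : n ≠ 0) (R : ℕ) :
    Integrable (fun ω : Fin n → ℝ => ∑ i, (n : ℝ)⁻¹ * tsq R (ω i)) (Measure.pi fun _ => ν) ∧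
    ∫ ω : Fin n → ℝ, ∑ i, (n : ℝ)⁻¹ * tsq R (ω i) ∂(Measure.pi fun _ => ν) = ∫ x, tsq R x ∂ν := by
  have := hν.1
  have hi : ∀ i : Fin n, Integrable (fun ω : Fin n → ℝ => (n : ℝ)⁻¹ * tsq R (ω i))
      (Measure.pi fun _ => ν) := fun i =>
    (integrable_comp_eval (μ := fun _ : Fin n => ν) (i := i) (tsq_int R hν.2)).const_mul _
  refine ⟨integrable_finsetSum _ fun i _ => hi i, ?_⟩
  rw [integral_finsetSum _ fun i _ => hi i]
  have : ∀ i : Fin n, ∫ ω : Fin n → ℝ, (n : ℝ)⁻¹ * tsq R (ω i) ∂(Measure.pi fun _ => ν)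
      = (n : ℝ)⁻¹ * ∫ x, tsq R x ∂ν := by
    intro i
    rw [integral_const_mul]
    congr 1
    exact integral_comp_eval (μ := fun _ : Fin n => ν) (i := i) (tsq_meas R).aestronglyMeasurable
  simp only [this]
  have : (n : ℝ) ≠ 0 := by exact_mod_cast hn
  simp [this]

lemma E_freq {ν : Measure ℝ} (hν : MemW2Space ν) {n : ℕ} (hn : n ≠ 0) {A : Set ℝ}
    (hA : MeasurableSet A) :
    Integrable (fun ω : Fin n → ℝ => (∑ i, (n : ℝ)⁻¹ * (A.indicator 1 (ω i) - ν.real A)) ^ 2)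
      (Measure.pi fun _ => ν) ∧
    ∫ ω : Fin n → ℝ, (∑ i, (n : ℝ)⁻¹ * (A.indicator 1 (ω i) - ν.real A)) ^ 2
      ∂(Measure.pi fun _ => ν) ≤ (n : ℝ)⁻¹ := by
  have := hν.1
  have hn' : (n : ℝ) ≠ 0 := by exact_mod_cast hn
  have hb : ∀ x : ℝ, |A.indicator 1 x - ν.real A| ≤ 1 := by
    intro x
    have h1 : ν.real A ≤ 1 := measureReal_le_one
    have h2 : 0 ≤ ν.real A := measureReal_nonneg
    by_cases hx : x ∈ A <;> simp only [hx, not_false_eq_true, Set.indicator_of_mem, Set.indicator_of_notMem, Pi.one_apply, abs_le] <;>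
      constructor <;> linarith
  have hmeas : Measurable (fun x : ℝ => A.indicator 1 x - ν.real A) :=
    (measurable_one.indicator hA).sub_const _
  have hL : MemLp (fun x : ℝ => A.indicator 1 x - ν.real A) 2 ν :=
    MemLp.of_bound hmeas.aestronglyMeasurable 1 (ae_of_all _ hb)
  have h0 : ∫ x, (A.indicator 1 x - ν.real A) ∂ν = 0 := by
    have i1 : Integrable (A.indicator (1 : ℝ → ℝ)) ν := (integrable_const (1:ℝ)).indicator hA
    rw [integral_sub i1 (integrable_const _),
      integral_indicator_one hA]
    simp
  obtain ⟨h1, h2⟩ := pi_sq ν (fun _ : Fin n => (n : ℝ)⁻¹) _ hL (Or.inr h0)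
  refine ⟨h1.integrable_sq, h2.trans ?_⟩
  have h3 : ∫ x, (A.indicator 1 x - ν.real A) ^ 2 ∂ν ≤ ∫ x, (1:ℝ) ∂ν := by
    refine integral_mono hL.integrable_sq (integrable_const _) fun x => ?_
    exact (sq_le_one_iff_abs_le_one _).2 (hb x)
  simp only [integral_const, probReal_univ, one_smul] at h3
  calc _ ≤ (∑ i : Fin n, (n : ℝ)⁻¹ ^ 2) * 1 := by gcongr
    _ = (n : ℝ)⁻¹ := by simp; field_simp

/-- With `m = m^{(n)}` contrast vectors (`Σ m_i = 0`, `Σ m_i² ≤ δ²`) and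
`X_1, …, X_n` i.i.d. `F n` lying in a `W2`-compact set `Δ₀`, the Wasserstein-2 distance
between the conditional (bootstrap) law of `Σ m_i X*_i` given the sample — where
`X*_1, …, X*_n` are i.i.d. from the empirical measure — and the law of `Σ m_i X_i` tends
to `0` in probability. -/
theorem bootstrap_linear_statistic_consistency
    (Δ₀ : Set (Measure ℝ)) (hΔ₀ : W2Compact Δ₀)
    (F : ℕ → Measure ℝ) (hF : ∀ n, F n ∈ Δ₀)
    (δ : ℝ) (hδ : 0 < δ)
    (m : ∀ n : ℕ, Fin n → ℝ)
    (hmbar : ∀ n, ∑ i, m n i = 0)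
    (hmnorm : ∀ n, ∑ i, m n i ^ 2 ≤ δ ^ 2) :
    ∀ ε > (0:ℝ),
      Tendsto (fun n => (Measure.pi fun _ : Fin n => F n)
          {ω | ε ≤ W2
            ((Measure.pi fun _ : Fin n => empiricalMeasure n ω).map
              (fun y => ∑ i, m n i * y i))
            ((Measure.pi fun _ : Fin n => F n).map
              (fun y => ∑ i, m n i * y i))}) atTop (nhds 0) := by
  intro ε hε
  rw [ENNReal.tendsto_atTop_zero]
  intro θ' hθ'
  obtain ⟨θ, hθ, hθθ⟩ : ∃ θ : ℝ, 0 < θ ∧ ENNReal.ofReal θ ≤ θ' := by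
    have h1 : min θ' 1 ≠ ⊤ := ne_top_of_le_ne_top ENNReal.one_ne_top (min_le_right _ _)
    refine ⟨(min θ' 1).toReal, ENNReal.toReal_pos (by simp [hθ'.ne']) h1, ?_⟩
    rw [ENNReal.ofReal_toReal h1]
    exact min_le_left _ _
  obtain ⟨L, hL, hLε⟩ : ∃ L : ℝ, 0 < L ∧ ε ^ 2 = δ ^ 2 * (2 * L) :=
    ⟨ε ^ 2 / (2 * δ ^ 2), by positivity, by field_simp⟩
  obtain ⟨R, hR⟩ := unif_int hΔ₀ (c := min (L / 8) (θ * L / 12)) (by positivity)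
  obtain ⟨N, f, hf, H⟩ := quant R (η := Real.sqrt (L / 2)) (by positivity)
  set C : ℝ := 4 * R ^ 2 * N with hC
  have hC0 : 0 ≤ C := by positivity
  set s : ℝ := θ * L / (3 * (C + 1)) with hs
  have hs0 : 0 < s := by positivity
  have hCs : C * s ≤ θ * L / 3 := by
    rw [hs, mul_div_assoc', div_le_div_iff₀ (by positivity) (by positivity)]
    nlinarith [mul_pos hθ hL]
  obtain ⟨n₀, hn₀⟩ := exists_nat_gt (C / s / (θ * L / 3))
  refine ⟨n₀ + 1, fun n hn => le_trans ?_ hθθ⟩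
  have hn0 : n ≠ 0 := by omega
  have hnpos : (0 : ℝ) < n := by exact_mod_cast Nat.pos_of_ne_zero hn0
  have hCn : C / s * (n : ℝ)⁻¹ ≤ θ * L / 3 := by
    have h1 : (n₀ : ℝ) ≤ n := by exact_mod_cast (by omega : n₀ ≤ n)
    have h2 : C / s / (θ * L / 3) ≤ n := by linarith
    rw [div_le_iff₀ (by positivity)] at h2
    rw [← div_eq_mul_inv, div_le_iff₀ hnpos]
    linarith
  have hFn := hΔ₀.1 _ (hF n)
  have := hFn.1
  have hT := hR _ (hF n)
  have hT1 := hT.trans (min_le_left _ _)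
  have hT2 := hT.trans (min_le_right _ _)
  set Z : Fin N → (Fin n → ℝ) → ℝ := fun j ω =>
    ∑ i, (n : ℝ)⁻¹ * ((f ⁻¹' {j}).indicator 1 (ω i) - (F n).real (f ⁻¹' {j})) with hZ
  set Y : (Fin n → ℝ) → ℝ := fun ω => 4 * R ^ 2 * (∑ j, (s + s⁻¹ * Z j ω ^ 2))
    + 4 * (∑ i, (n : ℝ)⁻¹ * tsq R (ω i)) with hY
  have hsub : {ω | ε ≤ W2
            ((Measure.pi fun _ : Fin n => empiricalMeasure n ω).map
              (fun y => ∑ i, m n i * y i))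
            ((Measure.pi fun _ : Fin n => F n).map
              (fun y => ∑ i, m n i * y i))} ⊆ {ω | L ≤ Y ω} := by
    intro ω hω
    have h1 : ε ≤ _ := le_trans hω (W2_point hFn hn0 ω (m n) (hmbar n) (hmnorm n) hf H)
    have h2 := (Real.le_sqrt' hε).1 h1
    rw [hLε, Real.sq_sqrt (by positivity)] at h2
    have h3 := le_of_mul_le_mul_left h2 (by positivity : 0 < δ ^ 2)
    have h4 : ∑ j, |Z j ω| ≤ ∑ j, (s + s⁻¹ * Z j ω ^ 2) := by
      refine Finset.sum_le_sum fun j _ => ?_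
      have : s * |Z j ω| ≤ s * (s + s⁻¹ * Z j ω ^ 2) := by
        rw [mul_add, mul_inv_cancel_left₀ hs0.ne', ← sq_abs (Z j ω)]
        nlinarith [sq_nonneg (s - |Z j ω|), abs_nonneg (Z j ω), sq_nonneg s, sq_nonneg (|Z j ω|)]
      exact le_of_mul_le_mul_left this hs0
    have h5 : 4 * (R:ℝ) ^ 2 * ∑ j, |Z j ω| ≤ 4 * R ^ 2 * ∑ j, (s + s⁻¹ * Z j ω ^ 2) := by gcongr
    simp only [Set.mem_ofPred_eq, hY]
    linarith
  have hYn : ∀ ω, 0 ≤ Y ω := fun ω => by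
    have : 0 ≤ ∑ i, (n : ℝ)⁻¹ * tsq R (ω i) :=
      Finset.sum_nonneg fun i _ => mul_nonneg (by positivity) (tsq_nonneg _ _)
    simp only [hY]
    positivity
  have hE1 := E_tsq hFn hn0 R
  have hE2 := fun j => E_freq hFn hn0 (hf (measurableSet_singleton j))
  have i1 : ∀ j, Integrable (fun ω => s + s⁻¹ * Z j ω ^ 2) (Measure.pi fun _ : Fin n => F n) :=
    fun j => (integrable_const _).add ((hE2 j).1.const_mul _)
  have i2 : Integrable (fun ω => 4 * (R:ℝ) ^ 2 * (∑ j, (s + s⁻¹ * Z j ω ^ 2)))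
      (Measure.pi fun _ : Fin n => F n) :=
    (integrable_finsetSum _ fun j _ => i1 j).const_mul _
  have i3 := hE1.1.const_mul 4
  have hEY : ∫ ω, Y ω ∂(Measure.pi fun _ : Fin n => F n) ≤ L * θ := by
    simp only [hY]
    rw [integral_add i2 i3, integral_const_mul, integral_const_mul, hE1.2,
      integral_finsetSum _ fun j _ => i1 j]
    have h1 : ∑ j, ∫ ω, (s + s⁻¹ * Z j ω ^ 2) ∂(Measure.pi fun _ : Fin n => F n)
        ≤ ∑ j : Fin N, (s + s⁻¹ * (n : ℝ)⁻¹) := by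
      refine Finset.sum_le_sum fun j _ => ?_
      rw [integral_add (integrable_const _) ((hE2 j).1.const_mul _), integral_const_mul]
      simp only [integral_const, probReal_univ, one_smul]
      gcongr
      exact (hE2 j).2
    rw [Finset.sum_const, Finset.card_univ, Fintype.card_fin, nsmul_eq_mul] at h1
    have h2 := mul_le_mul_of_nonneg_left h1 (by positivity : (0:ℝ) ≤ 4 * R ^ 2)
    have h3 : 4 * (R:ℝ) ^ 2 * (N * (s + s⁻¹ * (n : ℝ)⁻¹)) = C * s + C / s * (n : ℝ)⁻¹ := by
      rw [hC]; ring
    linarith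
  have hM := mul_meas_ge_le_integral_of_nonneg (ae_of_all _ hYn) (i2.add i3) L
  have hM2 := le_of_mul_le_mul_left (hM.trans hEY) hL
  refine (measure_mono hsub).trans ?_
  rw [← ENNReal.ofReal_toReal (measure_ne_top (Measure.pi fun _ : Fin n => F n) {ω | L ≤ Y ω})]
  exact ENNReal.ofReal_le_ofReal hM2
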